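/- Define μ(n, k) = (k+1)·C(n, k+1, k) / binom(n, k) as a rational number, whenever n > k+1 > 1. Then for all integers n > k > 1 (with n ≥ k+2), both inequalities hold: μ(n−1, k−1) ≤ μ(n, k) and ((n−k+1)/(n+1))·μ(n, k) ≤ μ(n+1, k). -/

import Mathlib

/-- `F` is a covering system witnessing `C(n, r, k)`: a family of `r`-element subsets of an
`n`-element set such that every `k`-element subset is contained in at least one member. -/
def IsCoveringSystem (n r k : ℕ) (F : Finset (Finset (Fin n))) : Prop :=
  (∀ e ∈ F, e.card = r) ∧ ∀ s : Finset (Fin n), s.card = k → ∃ e ∈ F, s ⊆ e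

/-- The covering number `C(n, r, k)`: the smallest size of a family of `r`-element subsets
of an `n`-element set such that every `k`-element subset is contained in at least one
member of the family. -/
noncomputable def coverNum (n r k : ℕ) : ℕ :=
  sInf {m | ∃ F : Finset (Finset (Fin n)), IsCoveringSystem n r k F ∧ F.card = m}

/-- `μ(n, k) = (k+1) · C(n, k+1, k) / binom(n, k)`, as a rational number. -/
noncomputable def mu (n k : ℕ) : ℚ :=
  ((k + 1) * coverNum n (k + 1) k : ℚ) / (Nat.choose n k : ℚ)

theorem coverNum_le_card {n r k : ℕ} {F : Finset (Finset (Fin n))}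
    (hF : IsCoveringSystem n r k F) : coverNum n r k ≤ F.card :=
  Nat.sInf_le ⟨F, hF, rfl⟩

theorem exists_isCoveringSystem_card_eq_coverNum {n r k : ℕ} (hkr : k ≤ r) (hrn : r ≤ n) :
    ∃ F : Finset (Finset (Fin n)), IsCoveringSystem n r k F ∧ F.card = coverNum n r k := by
  refine Nat.sInf_mem
    (s := {m | ∃ F : Finset (Finset (Fin n)), IsCoveringSystem n r k F ∧ F.card = m}) ?_
  refine ⟨_, Finset.univ.powersetCard r, ⟨fun e he => (Finset.mem_powersetCard.1 he).2, ?_⟩, rfl⟩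
  intro s hs
  obtain ⟨e, hse, -, he⟩ := Finset.exists_subsuperset_card_eq (Finset.subset_univ s)
    (hs.le.trans hkr) (by simpa using hrn)
  exact ⟨e, Finset.mem_powersetCard.2 ⟨Finset.subset_univ e, he⟩, hse⟩

/-- The trace of a subset of `Fin (n + 1)` on the complement of `p`, identified with `Fin n`. -/
def traceAt {n : ℕ} (p : Fin (n + 1)) (e : Finset (Fin (n + 1))) : Finset (Fin n) :=
  Finset.univ.filter fun i => p.succAbove i ∈ e

theorem mem_traceAt {n : ℕ} {p : Fin (n + 1)} {e : Finset (Fin (n + 1))} {i : Fin n} :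
    i ∈ traceAt p e ↔ p.succAbove i ∈ e := by
  simp [traceAt]

theorem map_traceAt {n : ℕ} (p : Fin (n + 1)) (e : Finset (Fin (n + 1))) :
    (traceAt p e).map p.succAboveEmb = e.erase p := by
  ext j
  simp only [Finset.mem_map, mem_traceAt, Fin.coe_succAboveEmb, Finset.mem_erase]
  constructor
  · rintro ⟨i, hi, rfl⟩
    exact ⟨Fin.succAbove_ne p i, hi⟩
  · rintro ⟨hj, hje⟩
    obtain ⟨i, rfl⟩ := Fin.exists_succAbove_eq hj
    exact ⟨i, hje, rfl⟩

theorem card_traceAt {n : ℕ} (p : Fin (n + 1)) (e : Finset (Fin (n + 1))) :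
    (traceAt p e).card = (e.erase p).card := by
  rw [← map_traceAt, Finset.card_map]

theorem IsCoveringSystem.link {n r k : ℕ} {F : Finset (Finset (Fin (n + 1)))}
    (hF : IsCoveringSystem (n + 1) (r + 1) (k + 1) F) (p : Fin (n + 1)) :
    IsCoveringSystem n r k ((F.filter (p ∈ ·)).image (traceAt p)) := by
  constructor
  · intro e he
    obtain ⟨f, hf, rfl⟩ := Finset.mem_image.1 he
    obtain ⟨hfF, hpf⟩ := Finset.mem_filter.1 hf
    rw [card_traceAt, Finset.card_erase_of_mem hpf, hF.1 f hfF, Nat.add_sub_cancel]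
  · intro s hs
    have hp : p ∉ s.map p.succAboveEmb := by simp [Fin.succAbove_ne]
    obtain ⟨f, hfF, hsf⟩ := hF.2 (insert p (s.map p.succAboveEmb))
      (by rw [Finset.card_insert_of_notMem hp, Finset.card_map, hs])
    rw [Finset.insert_subset_iff] at hsf
    refine ⟨traceAt p f,
      Finset.mem_image_of_mem _ (Finset.mem_filter.2 ⟨hfF, hsf.1⟩), fun i hi => ?_⟩
    exact mem_traceAt.2 (hsf.2 (Finset.mem_map_of_mem _ hi))

/-- The Schönheim inequality for covering numbers. -/
theorem succ_mul_coverNum_le {n r k : ℕ} (hkr : k ≤ r) (hrn : r ≤ n) :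
    (n + 1) * coverNum n r k ≤ (r + 1) * coverNum (n + 1) (r + 1) (k + 1) := by
  obtain ⟨F, hF, hcard⟩ := exists_isCoveringSystem_card_eq_coverNum
    (Nat.succ_le_succ hkr) (Nat.succ_le_succ hrn)
  calc (n + 1) * coverNum n r k = ∑ _p : Fin (n + 1), coverNum n r k := by simp
    _ ≤ ∑ p : Fin (n + 1), (F.filter (p ∈ ·)).card :=
        Finset.sum_le_sum fun p _ => (coverNum_le_card (hF.link p)).trans Finset.card_image_le
    _ = ∑ e ∈ F, e.card := by
        simp only [Finset.card_eq_sum_ones, Finset.sum_filter]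
        rw [Finset.sum_comm]
        simp
    _ = (r + 1) * coverNum (n + 1) (r + 1) (k + 1) := by
        rw [Finset.sum_congr rfl hF.1, Finset.sum_const, hcard, smul_eq_mul, mul_comm]

theorem coverNum_le_coverNum_succ {n r k : ℕ} (hkr : k ≤ r) (hrn : r ≤ n) :
    coverNum n r k ≤ coverNum (n + 1) r k := by
  obtain ⟨F, hF, hcard⟩ := exists_isCoveringSystem_card_eq_coverNum
    hkr (hrn.trans n.le_succ)
  have hext : ∀ e : Finset (Fin (n + 1)), ∃ e' : Finset (Fin n),
      e ∈ F → traceAt (Fin.last n) e ⊆ e' ∧ e'.card = r := by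
    intro e
    by_cases he : e ∈ F
    · obtain ⟨e', h, -, h'⟩ := Finset.exists_subsuperset_card_eq
        (Finset.subset_univ (traceAt (Fin.last n) e)) (n := r)
        (by rw [card_traceAt, ← hF.1 e he]; exact Finset.card_erase_le) (by simpa using hrn)
      exact ⟨e', fun _ => ⟨h, h'⟩⟩
    · exact ⟨∅, fun h => absurd h he⟩
  choose g hg using hext
  have hcov : IsCoveringSystem n r k (F.image g) := by
    constructor
    · intro e he
      obtain ⟨f, hf, rfl⟩ := Finset.mem_image.1 he
      exact (hg f hf).2
    · intro s hs
      obtain ⟨f, hf, hsf⟩ := hF.2 (s.map (Fin.last n).succAboveEmb) (by rw [Finset.card_map, hs])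
      exact ⟨g f, Finset.mem_image_of_mem _ hf, fun i hi =>
        (hg f hf).1 (mem_traceAt.2 (hsf (Finset.mem_map_of_mem _ hi)))⟩
  exact (coverNum_le_card hcov).trans (Finset.card_image_le.trans hcard.le)

theorem mu_le_mu_succ_succ {n k : ℕ} (hkn : k + 1 ≤ n) : mu n k ≤ mu (n + 1) (k + 1) := by
  have hlink : ((n : ℚ) + 1) * coverNum n (k + 1) k ≤
      ((k : ℚ) + 1 + 1) * coverNum (n + 1) (k + 1 + 1) (k + 1) := by
    exact_mod_cast succ_mul_coverNum_le k.le_succ hkn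
  have hchoose : ((n : ℚ) + 1) * n.choose k = (n + 1).choose (k + 1) * ((k : ℚ) + 1) := by
    exact_mod_cast Nat.add_one_mul_choose_eq n k
  have hpos : (0 : ℚ) < n.choose k := by exact_mod_cast Nat.choose_pos (by omega)
  have hpos' : (0 : ℚ) < (n + 1).choose (k + 1) := by exact_mod_cast Nat.choose_pos (by omega)
  have hmu : mu n k = (((n : ℚ) + 1) * coverNum n (k + 1) k) / (n + 1).choose (k + 1) := by
    rw [mu, div_eq_div_iff hpos.ne' hpos'.ne']
    linear_combination -(coverNum n (k + 1) k : ℚ) * hchoose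
  rw [hmu, mu]
  push_cast
  gcongr

theorem mul_mu_le_mu_succ {n k : ℕ} (hkn : k + 1 ≤ n) :
    (((n : ℚ) - (k : ℚ) + 1) / ((n : ℚ) + 1)) * mu n k ≤ mu (n + 1) k := by
  have hmono : (coverNum n (k + 1) k : ℚ) ≤ coverNum (n + 1) (k + 1) k := by
    exact_mod_cast coverNum_le_coverNum_succ k.le_succ hkn
  have hchoose : (n.choose k : ℚ) * ((n : ℚ) + 1) =
      (n + 1).choose k * ((n : ℚ) - (k : ℚ) + 1) := by
    have h : ((n + 1 - k : ℕ) : ℚ) = (n : ℚ) - k + 1 := by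
      rw [Nat.cast_sub (by omega)]
      push_cast
      ring
    rw [← h]
    exact_mod_cast Nat.choose_mul_succ_eq n k
  have hpos : (0 : ℚ) < n.choose k := by exact_mod_cast Nat.choose_pos (by omega)
  have hpos' : (0 : ℚ) < (n + 1).choose k := by exact_mod_cast Nat.choose_pos (by omega)
  have hmu : (((n : ℚ) - (k : ℚ) + 1) / ((n : ℚ) + 1)) * mu n k =
      (((k : ℚ) + 1) * coverNum n (k + 1) k) / (n + 1).choose k := by
    rw [mu, div_mul_div_comm, div_eq_div_iff (by positivity) hpos'.ne']
    linear_combination -((k : ℚ) + 1) * coverNum n (k + 1) k * hchoose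
  rw [hmu, mu]
  gcongr

/-- For all integers `n > k > 1` (with `n ≥ k + 2`), both inequalities hold:
`μ(n−1, k−1) ≤ μ(n, k)` and `((n−k+1)/(n+1)) · μ(n, k) ≤ μ(n+1, k)`. -/
theorem mu_monotonicity {n k : ℕ} (hk : 1 < k) (hn : k + 2 ≤ n) :
    mu (n - 1) (k - 1) ≤ mu n k ∧
    (((n : ℚ) - (k : ℚ) + 1) / ((n : ℚ) + 1)) * mu n k ≤ mu (n + 1) k := by
  refine ⟨?_, mul_mu_le_mu_succ (by omega)⟩
  have h := mu_le_mu_succ_succ (n := n - 1) (k := k - 1) (by omega)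
  rwa [Nat.sub_add_cancel (by omega), Nat.sub_add_cancel (by omega)] at h
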